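/- Let μ be a nonnegative integer and z ∈ ℂ be such that q^{s−z+j} ≠ 1 for all integers a ≤ s ≤ b−1 and all integers 0 ≤ j ≤ μ+2. Then the backward difference in z of Φ_{ν,μ} satisfies Φ_{ν,μ}(z) − Φ_{ν,μ}(z−1) = [μ+1]_q · ( x_{ν−μ}(z) − x_{ν−μ}(z−1) ) · Φ_{ν,μ+1}(z). -/

import Mathlib

noncomputable section

/-- `q^w := exp(w · log q)` for a complex exponent `w`. -/
def qp (q : ℝ) (w : ℂ) : ℂ := Complex.exp (w * (Real.log q : ℂ))

/-- The symmetric q-number `[t]_q = (q^{t/2} − q^{−t/2})/(q^{1/2} − q^{−1/2})`. -/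
def qnum (q : ℝ) (t : ℂ) : ℂ :=
  (qp q (t/2) - qp q (-(t/2))) / (qp q (1/2) - qp q (-(1/2)))

/-- Generalized power `[x_k(s) − x_k(z)]^{(n)}` on the q-linear lattice
`x(s) = c₁·q^s + c₂`. -/
def gp (q : ℝ) (c₁ : ℂ) (n : ℕ) (k s z : ℂ) : ℂ :=
  (-1 : ℂ)^n * c₁^n * qp q (-((n*(n-1) : ℕ) : ℂ)/2) * qp q ((n : ℂ) * (z + k/2)) *
    ∏ j ∈ Finset.range n, (1 - qp q (s - z + (j : ℂ)))

/-- The shifted q-linear lattice `x_k(s) = c₁·q^{s+k/2} + c₂`. -/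
def latt (q : ℝ) (c₁ c₂ : ℂ) (k s : ℂ) : ℂ := c₁ * qp q (s + k/2) + c₂

/-- The function `Φ_{ν,μ}(z) = ∑_{s=a}^{b−1} ρ(s)·∇x_{ν+1}(s)/[x_ν(s) − x_ν(z)]^{(μ+1)}`. -/
def Phi (q : ℝ) (c₁ c₂ : ℂ) (ρ : ℤ → ℂ) (a b : ℤ) (ν : ℂ) (μ : ℕ) (z : ℂ) : ℂ :=
  ∑ s ∈ Finset.Icc a (b - 1),
    ρ s * (latt q c₁ c₂ (ν + 1) (s : ℂ) - latt q c₁ c₂ (ν + 1) ((s : ℂ) - 1)) /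
      gp q c₁ (μ + 1) ν (s : ℂ) z

theorem qp_add (q : ℝ) (v w : ℂ) : qp q (v + w) = qp q v * qp q w := by
  simp only [qp, add_mul, Complex.exp_add]

theorem qp_ne_zero (q : ℝ) (w : ℂ) : qp q w ≠ 0 := Complex.exp_ne_zero _

theorem qp_zero (q : ℝ) : qp q 0 = 1 := by simp [qp]

theorem qp_half_ne_qp_neg_half {q : ℝ} (hq : 0 < q) (hq1 : q ≠ 1) :
    qp q (1 / 2) - qp q (-(1 / 2)) ≠ 0 := by
  intro h
  have h1 : qp q 1 = 1 := by
    rw [show (1 : ℂ) = 1 / 2 + 1 / 2 by norm_num, qp_add]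
    nth_rewrite 1 [sub_eq_zero.mp h]
    rw [← qp_add, neg_add_cancel, qp_zero]
    norm_num
  rw [qp, one_mul, ← Complex.ofReal_exp, Real.exp_log hq] at h1
  exact hq1 (by exact_mod_cast h1)

theorem qnum_mul_latt_sub {q : ℝ} (hq : 0 < q) (hq1 : q ≠ 1) (c₁ c₂ t k z : ℂ) :
    qnum q t * (latt q c₁ c₂ (k + 1 - t) z - latt q c₁ c₂ (k + 1 - t) (z - 1)) =
      c₁ * qp q (z + k / 2) * (1 - qp q (-t)) := by
  have hd := qp_half_ne_qp_neg_half hq hq1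
  have hlatt : latt q c₁ c₂ (k + 1 - t) z - latt q c₁ c₂ (k + 1 - t) (z - 1) =
      c₁ * qp q (z + k / 2) * qp q (-(t / 2)) * (qp q (1 / 2) - qp q (-(1 / 2))) := by
    have h₁ : z + (k + 1 - t) / 2 = z + k / 2 + -(t / 2) + 1 / 2 := by ring
    have h₂ : z - 1 + (k + 1 - t) / 2 = z + k / 2 + -(t / 2) + -(1 / 2) := by ring
    simp only [latt, h₁, h₂, qp_add q (z + k / 2 + -(t / 2)), qp_add q (z + k / 2)]
    ring
  have hinv : qp q (t / 2) * qp q (-(t / 2)) = 1 := by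
    rw [← qp_add, add_neg_cancel, qp_zero]
  have hsq : qp q (-t) = qp q (-(t / 2)) * qp q (-(t / 2)) := by
    rw [← qp_add]
    ring_nf
  rw [hlatt, qnum, hsq, div_mul_eq_mul_div, div_eq_iff hd]
  linear_combination c₁ * qp q (z + k / 2) * (qp q (1 / 2) - qp q (-(1 / 2))) * hinv

theorem gp_succ (q : ℝ) (c₁ : ℂ) (n : ℕ) (k s z : ℂ) :
    gp q c₁ (n + 1) k s z =
      -(gp q c₁ n k s z * c₁ * qp q (-n) * qp q (z + k / 2) * (1 - qp q (s - z + n))) := by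
  have h₁ : -(((n + 1) * (n + 1 - 1) : ℕ) : ℂ) / 2 = -((n * (n - 1) : ℕ) : ℂ) / 2 + -n := by
    cases n with
    | zero => simp
    | succ m =>
      push_cast [Nat.add_sub_cancel]
      ring
  have h₂ : ((n + 1 : ℕ) : ℂ) * (z + k / 2) = n * (z + k / 2) + (z + k / 2) := by
    push_cast
    ring
  rw [gp, gp, h₁, h₂, qp_add, qp_add q (n * (z + k / 2)), Finset.prod_range_succ]
  ring

theorem gp_sub_one (q : ℝ) (c₁ : ℂ) (n : ℕ) (k s z : ℂ) :
    gp q c₁ n k s (z - 1) * (1 - qp q (s - z)) =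
      gp q c₁ n k s z * qp q (-n) * (1 - qp q (s - z + n)) := by
  have hprod : (∏ j ∈ Finset.range n, (1 - qp q (s - (z - 1) + j))) * (1 - qp q (s - z)) =
      (∏ j ∈ Finset.range n, (1 - qp q (s - z + j))) * (1 - qp q (s - z + n)) := by
    rw [← Finset.prod_range_succ (fun j : ℕ => 1 - qp q (s - z + j)), Finset.prod_range_succ']
    congr 1
    · refine Finset.prod_congr rfl fun j _ => ?_
      push_cast
      ring_nf
    · simp
  have h : (n : ℂ) * (z - 1 + k / 2) = n * (z + k / 2) + -n := by ring
  rw [gp, gp, h, qp_add q (n * (z + k / 2))]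
  linear_combination (-1 : ℂ) ^ n * c₁ ^ n * qp q (-((n * (n - 1) : ℕ) : ℂ) / 2) *
    (qp q (n * (z + k / 2)) * qp q (-n)) * hprod

theorem gp_ne_zero {q : ℝ} {c₁ : ℂ} (hc₁ : c₁ ≠ 0) {n : ℕ} (k : ℂ) {s z : ℂ}
    (h : ∀ j < n, qp q (s - z + (j : ℂ)) ≠ 1) : gp q c₁ n k s z ≠ 0 := by
  have hprod : ∏ j ∈ Finset.range n, (1 - qp q (s - z + (j : ℂ))) ≠ 0 :=
    Finset.prod_ne_zero_iff.mpr fun j hj => sub_ne_zero.mpr (h j (Finset.mem_range.mp hj)).symm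
  simp [gp, hc₁, qp_ne_zero, hprod]

theorem inv_gp_sub_inv_gp {q : ℝ} {c₁ : ℂ} (hc₁ : c₁ ≠ 0) {n : ℕ} (k : ℂ) {s z : ℂ}
    (h : ∀ j ≤ n, qp q (s - z + (j : ℂ)) ≠ 1) :
    (gp q c₁ n k s z)⁻¹ - (gp q c₁ n k s (z - 1))⁻¹ =
      c₁ * qp q (z + k / 2) * (1 - qp q (-n)) * (gp q c₁ (n + 1) k s z)⁻¹ := by
  have hG : gp q c₁ n k s z ≠ 0 := gp_ne_zero hc₁ k fun j hj => h j hj.le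
  have hX : 1 - qp q (s - z) ≠ 0 := sub_ne_zero.mpr (by simpa using (h 0 n.zero_le).symm)
  have hY : 1 - qp q (s - z + n) ≠ 0 := sub_ne_zero.mpr (h n le_rfl).symm
  have hN := qp_ne_zero q (-n)
  have hQ := qp_ne_zero q (z + k / 2)
  have hNY : qp q (-n) * qp q (s - z + n) = qp q (s - z) := by
    rw [← qp_add]
    ring_nf
  rw [gp_succ, eq_div_of_mul_eq hX (gp_sub_one q c₁ n k s z)]
  generalize qp q (z + k / 2) = Q at *
  field_simp
  linear_combination -hNY

theorem stmt6 (q : ℝ) (hq : 0 < q) (hq1 : q ≠ 1) (c₁ c₂ : ℂ) (hc₁ : c₁ ≠ 0)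
    (a b : ℤ) (hab : a < b) (ρ : ℤ → ℂ) (ν : ℂ) (μ : ℕ) (z : ℂ)
    (hadm : ∀ s : ℤ, a ≤ s → s ≤ b - 1 → ∀ j : ℕ, j ≤ μ + 2 →
      qp q ((s : ℂ) - z + (j : ℂ)) ≠ 1) :
    Phi q c₁ c₂ ρ a b ν μ z - Phi q c₁ c₂ ρ a b ν μ (z - 1) =
      qnum q ((μ : ℂ) + 1) *
        (latt q c₁ c₂ (ν - (μ : ℂ)) z - latt q c₁ c₂ (ν - (μ : ℂ)) (z - 1)) *
        Phi q c₁ c₂ ρ a b ν (μ + 1) z := by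
  have hQ := qnum_mul_latt_sub hq hq1 c₁ c₂ ((μ : ℂ) + 1) ν z
  rw [add_sub_add_right_eq_sub] at hQ
  rw [hQ, Phi, Phi, Phi, ← Finset.sum_sub_distrib, Finset.mul_sum]
  refine Finset.sum_congr rfl fun s hs => ?_
  obtain ⟨has, hsb⟩ := Finset.mem_Icc.mp hs
  have key := inv_gp_sub_inv_gp hc₁ ν (n := μ + 1) (s := (s : ℂ)) (z := z)
    fun j hj => hadm s has hsb j (by omega)
  push_cast at key
  simp only [div_eq_mul_inv] at key ⊢
  linear_combination
    ρ s * (latt q c₁ c₂ (ν + 1) s - latt q c₁ c₂ (ν + 1) (s - 1)) * key
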